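/- arXiv:2205.05363 — 5 statements merged into one kernel-verified Lean document; each statement's English description precedes it below -/
import Mathlib

section
/- For any instance with n agents with additive valuations over a finite set of items, any ρ > 0, and any allocation A = (A_1,…,A_n) satisfying v^i(A_i) ≥ ρ·MMS^i for every agent i, there exists an allocation A* = (A*_1,…,A*_n) satisfying v^i(A*_i) ≥ ρ·MMS^i for every agent i and, in addition, some agent j receives at least her proportional share: v^j(A*_j) ≥ PS^j. -/
/-- The total value of the bundle given to agent `j` by allocation/partition `f`. -/
noncomputable def bundleVal {M : Type*} [Fintype M] {n : ℕ} (v : M → ℝ)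
    (f : M → Fin n) (j : Fin n) : ℝ :=
  ∑ e ∈ Finset.univ.filter (fun e => f e = j), v e

/-- The maximin share: max over partitions into `n` bundles of the min bundle value. -/
noncomputable def MMS {M : Type*} [Fintype M] [DecidableEq M] (n : ℕ) [NeZero n]
    (v : M → ℝ) : ℝ :=
  Finset.univ.sup' Finset.univ_nonempty fun f : M → Fin n =>
    Finset.univ.inf' Finset.univ_nonempty fun j => bundleVal v f j

/-- The minimax share: min over partitions into `n` bundles of the max bundle value. -/
noncomputable def mmS {M : Type*} [Fintype M] [DecidableEq M] (n : ℕ) [NeZero n]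
    (v : M → ℝ) : ℝ :=
  Finset.univ.inf' Finset.univ_nonempty fun f : M → Fin n =>
    Finset.univ.sup' Finset.univ_nonempty fun j => bundleVal v f j

/-- The proportional share: total value divided by the number `n` of agents. -/
noncomputable def PS {M : Type*} [Fintype M] (n : ℕ) (v : M → ℝ) : ℝ :=
  (∑ e, v e) / n

theorem bundleVal_symm_comp {M : Type*} [Fintype M] {n : ℕ} (v : M → ℝ) (f : M → Fin n)
    (σ : Equiv.Perm (Fin n)) (j : Fin n) :
    bundleVal v (fun e => σ.symm (f e)) j = bundleVal v f (σ j) := by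
  simp only [bundleVal, Equiv.symm_apply_eq]

theorem exists_bundleVal_max_ge_PS {M : Type*} [Fintype M] (n : ℕ) [NeZero n] (v : M → ℝ)
    (f : M → Fin n) :
    ∃ k, (∀ j, bundleVal v f j ≤ bundleVal v f k) ∧ PS n v ≤ bundleVal v f k := by
  obtain ⟨k, hk⟩ := Finite.exists_max (bundleVal v f)
  refine ⟨k, hk, ?_⟩
  have hn : (0 : ℝ) < n := by exact_mod_cast NeZero.pos n
  rw [PS, div_le_iff₀ hn, ← Finset.sum_fiberwise Finset.univ f v]
  calc ∑ j, bundleVal v f j ≤ ∑ _j : Fin n, bundleVal v f k := Finset.sum_le_sum fun j _ => hk j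
    _ = bundleVal v f k * n := by simp [mul_comm]

theorem periodicPts_nonempty {α : Type*} [Finite α] [Nonempty α] (f : α → α) :
    (Function.periodicPts f).Nonempty := by
  obtain ⟨x⟩ := ‹Nonempty α›
  obtain ⟨a, b, hab, h⟩ := Finite.exists_ne_map_eq_of_infinite fun k : ℕ => f^[k] x
  wlog hlt : a < b generalizing a b
  · exact this b a hab.symm h.symm (by omega)
  refine ⟨f^[a] x, Function.mk_mem_periodicPts (Nat.sub_pos_of_lt hlt) ?_⟩
  rw [Function.IsPeriodicPt, Function.IsFixedPt, ← Function.iterate_add_apply,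
    Nat.sub_add_cancel hlt.le]
  exact h.symm

/-- A self-map of a finite type agrees on its periodic points with a permutation fixing
everything else. -/
theorem exists_perm_eq_on_periodicPts {α : Type*} [Finite α] (f : α → α) :
    ∃ σ : Equiv.Perm α, (∀ x ∈ Function.periodicPts f, σ x = f x) ∧
      ∀ x ∉ Function.periodicPts f, σ x = x := by
  classical
  have hf := Function.bijOn_periodicPts f
  let g : α → α := fun x => if x ∈ Function.periodicPts f then f x else x
  have hg : Function.Injective g := by
    intro x y hxy
    by_cases hx : x ∈ Function.periodicPts f <;> by_cases hy : y ∈ Function.periodicPts f <;>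
      simp only [g, hx, hy, if_true, if_false] at hxy
    · exact hf.injOn hx hy hxy
    · exact absurd (hxy ▸ hf.mapsTo hx) hy
    · exact absurd (hxy ▸ hf.mapsTo hy) hx
    · exact hxy
  refine ⟨Equiv.ofBijective g (Finite.injective_iff_bijective.mp hg), ?_, ?_⟩ <;>
    intro x hx <;> simp [g, hx]

/-- Every ρ-MMS allocation can be transformed into a ρ-MMS allocation in
which some agent also gets at least her proportional share. -/
theorem exists_rhoMMS_with_proportional_agent {M : Type*} [Fintype M] [DecidableEq M]
    (n : ℕ) [NeZero n] (v : Fin n → M → ℝ) (ρ : ℝ) (hρ : 0 < ρ) (A : M → Fin n)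
    (hA : ∀ i, ρ * MMS n (v i) ≤ bundleVal (v i) A i) :
    ∃ B : M → Fin n, (∀ i, ρ * MMS n (v i) ≤ bundleVal (v i) B i) ∧
      ∃ j, PS n (v j) ≤ bundleVal (v j) B j := by
  choose f hmax hPS using fun i => exists_bundleVal_max_ge_PS n (v i) A
  obtain ⟨σ, hσ, hfix⟩ := exists_perm_eq_on_periodicPts f
  refine ⟨fun e => σ.symm (A e), fun i => (hA i).trans ?_, ?_⟩
  · rw [bundleVal_symm_comp]
    by_cases hi : i ∈ Function.periodicPts f
    · rw [hσ i hi]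
      exact hmax i i
    · rw [hfix i hi]
  · obtain ⟨j, hj⟩ := periodicPts_nonempty f
    refine ⟨j, ?_⟩
    rw [bundleVal_symm_comp, hσ j hj]
    exact hPS j
end

section
/- Let A = (A_1,…,A_n) be an allocation of a finite set of items among n agents with additive valuations, and suppose A is Pareto optimal, i.e., there is no allocation A' with v^i(A'_i) ≥ v^i(A_i) for every agent i and v^j(A'_j) > v^j(A_j) for at least one agent j. Then A has an envy-free agent: there exists an agent i such that v^i(A_i) ≥ v^i(A_j) for every agent j. -/
/-- A self-map of a nonempty finite type has a periodic point. -/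
theorem exists_mem_periodicPts {α : Type*} [Finite α] [Nonempty α] (f : α → α) :
    ∃ x, x ∈ Function.periodicPts f := by
  obtain ⟨x⟩ := ‹Nonempty α›
  obtain ⟨a, b, hab, h⟩ := Finite.exists_ne_map_eq_of_infinite fun k : ℕ => f^[k] x
  wlog hlt : a < b generalizing a b
  · exact this b a hab.symm h.symm (by omega)
  refine ⟨f^[a] x, Function.mk_mem_periodicPts (Nat.sub_pos_of_lt hlt) ?_⟩
  change f^[b - a] (f^[a] x) = f^[a] x
  rw [← Function.iterate_add_apply, Nat.sub_add_cancel hlt.le]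
  exact h.symm

/-- If every element `i` of a nonempty finite type is mapped to some `f i`, then some permutation
moves the elements of a nonempty set (a union of cycles) along `f` and fixes all others. -/
theorem exists_perm_eq_or_eq_self {α : Type*} [Finite α] [Nonempty α] (f : α → α) :
    ∃ p : Equiv.Perm α, (∀ i, p i = f i ∨ p i = i) ∧ ∃ j, p j = f j := by
  classical
  let S := Function.periodicPts f
  have hS : Set.BijOn f S S := Function.bijOn_periodicPts f
  let g : α → α := fun i => if i ∈ S then f i else i
  have hg : Function.Injective g := by
    intro i j hij
    by_cases hi : i ∈ S <;> by_cases hj : j ∈ S <;> simp only [g, hi, hj, if_true, if_false] at hij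
    · exact hS.injOn hi hj hij
    · exact absurd (hij ▸ hS.mapsTo hi) hj
    · exact absurd (hij ▸ hS.mapsTo hj) hi
    · exact hij
  obtain ⟨x, hx⟩ := exists_mem_periodicPts f
  refine ⟨Equiv.ofBijective g (Finite.injective_iff_bijective.mp hg), fun i => ?_, x, if_pos hx⟩
  by_cases hi : i ∈ S
  · exact Or.inl (if_pos hi)
  · exact Or.inr (if_neg hi)

/-- Permuting the bundles of an allocation so that agent `i` receives the bundle of `p i`. -/
theorem bundleVal_perm_symm {M : Type*} [Fintype M] {n : ℕ} (v : M → ℝ) (A : M → Fin n)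
    (p : Equiv.Perm (Fin n)) (i : Fin n) :
    bundleVal v (fun e => p.symm (A e)) i = bundleVal v A (p i) := by
  simp only [bundleVal, Equiv.symm_apply_eq]

/-- Every Pareto optimal allocation has an envy-free agent. -/
theorem pareto_optimal_has_envy_free_agent {M : Type*} [Fintype M] (n : ℕ) [NeZero n]
    (v : Fin n → M → ℝ) (A : M → Fin n)
    (hPO : ¬ ∃ B : M → Fin n,
      (∀ i, bundleVal (v i) A i ≤ bundleVal (v i) B i) ∧
      ∃ j, bundleVal (v j) A j < bundleVal (v j) B j) :
    ∃ i, ∀ j, bundleVal (v i) A j ≤ bundleVal (v i) A i := by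
  by_contra! henvy
  choose f hf using henvy
  obtain ⟨p, hp, j, hj⟩ := exists_perm_eq_or_eq_self f
  refine hPO ⟨fun e => p.symm (A e), fun i => ?_, j, ?_⟩
  · rw [bundleVal_perm_symm]
    rcases hp i with h | h <;> rw [h]
    exact (hf i).le
  · rw [bundleVal_perm_symm, hj]
    exact hf j
end

section
/- Let ρ < 1 and let I be an instance with n agents having additive nonnegative valuations over a finite set M of items. Fix for each agent i an optimal MMS partition P^i of M (a partition into n bundles whose minimum v^i-value equals MMS^i), and call each nonempty intersection of one bundle from each of the n partitions an atomic bundle; an allocation is atomic if every atomic bundle is contained in a single bundle of the allocation. If in every atomic allocation A of I some agent i receives value v^i(A_i) ≤ ρ·MMS^i, then there exists an instance I' with n agents having additive nonnegative valuations in which in every allocation some agent i receives value at most ρ times her maximin share in I'. -/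
/-- Merging items along `g : M → M'` preserves bundle values, when partitions of `M'` are pulled
back to `M`. -/
theorem bundleVal_fiberwise {M M' : Type*} [Fintype M] [Fintype M'] [DecidableEq M'] {n : ℕ}
    (v : M → ℝ) (g : M → M') (f : M' → Fin n) (j : Fin n) :
    bundleVal (fun c => ∑ e with g e = c, v e) f j = bundleVal v (f ∘ g) j := by
  unfold bundleVal
  rw [← Finset.sum_fiberwise_of_maps_to (s := Finset.univ.filter fun e => (f ∘ g) e = j)
    (t := Finset.univ.filter fun c => f c = j) (g := g) (by simp)]
  refine Finset.sum_congr rfl fun c hc => Finset.sum_congr ?_ fun _ _ => rfl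
  ext e
  have hc' : f c = j := by simpa using hc
  simp only [Finset.mem_filter, Finset.mem_univ, true_and, Function.comp_apply]
  exact ⟨fun h => ⟨h ▸ hc', h⟩, And.right⟩

/-- If an optimal partition of `M` factors through `g : M → M'`, then merging items along `g`
preserves the maximin share. -/
theorem MMS_fiberwise {M M' : Type*} [Fintype M] [DecidableEq M] [Fintype M'] [DecidableEq M']
    {n : ℕ} [NeZero n] (v : M → ℝ) (g : M → M') (f : M' → Fin n)
    (hf : (Finset.univ.inf' Finset.univ_nonempty fun j => bundleVal v (f ∘ g) j) = MMS n v) :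
    MMS n (fun c => ∑ e with g e = c, v e) = MMS n v := by
  apply le_antisymm
  · refine Finset.sup'_le _ _ fun h _ => ?_
    simp only [bundleVal_fiberwise]
    exact Finset.le_sup' (fun p : M → Fin n =>
      Finset.univ.inf' Finset.univ_nonempty fun j => bundleVal v p j) (Finset.mem_univ (h ∘ g))
  · rw [← hf]
    simp only [← bundleVal_fiberwise]
    exact Finset.le_sup' (fun p : M' → Fin n => Finset.univ.inf' Finset.univ_nonempty fun j =>
      bundleVal (fun c => ∑ e with g e = c, v e) p j) (Finset.mem_univ f)

/-- If on some instance every atomic allocation (w.r.t. fixed optimal MMS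
partitions of all agents) gives some agent at most ρ·MMS (ρ < 1), then there is an
instance in which every allocation gives some agent at most ρ times her maximin share. -/
theorem atomic_exhaustive_search_negative_instance (n : ℕ) [NeZero n]
    {M : Type} [Fintype M] [DecidableEq M]
    (v : Fin n → M → ℝ) (hv : ∀ i e, 0 ≤ v i e) (ρ : ℝ) (hρ : ρ < 1)
    (P : Fin n → M → Fin n)
    (hP : ∀ i, (Finset.univ.inf' Finset.univ_nonempty fun j => bundleVal (v i) (P i) j)
      = MMS n (v i))
    (hatomic : ∀ A : M → Fin n, (∀ e e', (∀ i, P i e = P i e') → A e = A e') →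
      ∃ i, bundleVal (v i) A i ≤ ρ * MMS n (v i)) :
    ∃ (M' : Type) (i1 : Fintype M') (i2 : DecidableEq M') (v' : Fin n → M' → ℝ),
      (∀ i e, 0 ≤ v' i e) ∧
      ∀ A' : M' → Fin n, ∃ i,
        @bundleVal M' i1 n (v' i) A' i ≤ ρ * @MMS M' i1 i2 n _ (v' i) := by
  let g : M → Fin n → Fin n := fun e i => P i e
  refine ⟨Fin n → Fin n, inferInstance, inferInstance, fun i c => ∑ e with g e = c, v i e,
    fun i c => Finset.sum_nonneg fun e _ => hv i e, fun A' => ?_⟩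
  obtain ⟨i, hi⟩ := hatomic (A' ∘ g) fun e e' h => congrArg A' (funext h)
  refine ⟨i, ?_⟩
  rw [bundleVal_fiberwise, MMS_fiberwise (v i) g (fun c => c i) (hP i)]
  exact hi
end

section
/- For every instance with three agents having additive nonnegative valuations over a finite set of items, and for every prespecified agent u among the three, there exists an allocation A = (A_1,A_2,A_3) in which agent u receives at least her full proportional share, v^u(A_u) ≥ PS^u, and each of the other two agents i receives v^i(A_i) ≥ (11/12)·MMS^i. (That is, an (11/12)-P⁺MM allocation always exists for goods.) -/
/-- The value, for weights `w`, of the items that the two-colouring `s` paints with `b`. -/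
def colourVal (w : Fin 6 → ℝ) (s : Fin 6 → Bool) (b : Bool) : ℝ :=
  ∑ k, if s k = b then w k else 0

/-- No two-colouring of the items makes both colours worth at least `11/12`. -/
def Unsplittable (w : Fin 6 → ℝ) : Prop :=
  ∀ s : Fin 6 → Bool, colourVal w s true < 11 / 12 ∨ colourVal w s false < 11 / 12

theorem Unsplittable.comp_perm {w : Fin 6 → ℝ} (H : Unsplittable w)
    (σ : Equiv.Perm (Fin 6)) : Unsplittable (w ∘ σ) := by
  have key : ∀ s b, colourVal (w ∘ σ) s b = colourVal w (s ∘ σ.symm) b := by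
    intro s b
    unfold colourVal
    rw [← Equiv.sum_comp σ fun k => if (s ∘ σ.symm) k = b then w k else 0]
    simp
  intro s
  simpa only [key] using H (s ∘ σ.symm)

theorem Unsplittable.swap_cols {a b c d e f : ℝ} (H : Unsplittable ![a, b, c, d, e, f]) :
    Unsplittable ![a, c, b, d, f, e] := by
  convert H.comp_perm (Equiv.swap 1 2 * Equiv.swap 4 5) using 1
  funext k
  fin_cases k <;> rfl

/-- A nonnegative `3 × 3` matrix with rows `(a, b, c)`, `(d, e, f)`, `(g, h, i)` whose columns sum
to one, whose second and third row are worth little, and whose first row can be shared evenly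
neither together with the second row nor together with the third one. -/
structure IsLopsided (a b c d e f g h i : ℝ) : Prop where
  nonneg : 0 ≤ a ∧ 0 ≤ b ∧ 0 ≤ c ∧ 0 ≤ d ∧ 0 ≤ e ∧ 0 ≤ f ∧ 0 ≤ g ∧ 0 ≤ h ∧ 0 ≤ i
  col_sum : a + d + g = 1 ∧ b + e + h = 1 ∧ c + f + i = 1
  row_lt : d + e + f < 11 / 12 ∧ g + h + i < 11 / 12
  corner_lt : a + b < 11 / 12 ∧ a + c < 11 / 12
  split₂ : Unsplittable ![a, b, c, d, e, f]
  split₃ : Unsplittable ![a, b, c, g, h, i]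

namespace IsLopsided

variable {a b c d e f g h i : ℝ}

theorem swap_rows (H : IsLopsided a b c d e f g h i) : IsLopsided a b c g h i d e f where
  nonneg := by have := H.nonneg; tauto
  col_sum := by obtain ⟨h₁, h₂, h₃⟩ := H.col_sum; exact ⟨by linarith, by linarith, by linarith⟩
  row_lt := H.row_lt.symm
  corner_lt := H.corner_lt
  split₂ := H.split₃
  split₃ := H.split₂

theorem swap_cols (H : IsLopsided a b c d e f g h i) : IsLopsided a c b d f e g i h where
  nonneg := by have := H.nonneg; tauto
  col_sum := by have := H.col_sum; tauto
  row_lt := by obtain ⟨h₁, h₂⟩ := H.row_lt; exact ⟨by linarith, by linarith⟩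
  corner_lt := H.corner_lt.symm
  split₂ := H.split₂.swap_cols
  split₃ := H.split₃.swap_cols

theorem bend_lt (H : IsLopsided a b c d e f g h i) : a + g + h < 11 / 12 := by
  obtain ⟨ha, hb, hc, hd, he, hf, hg, hh, hi⟩ := H.nonneg
  obtain ⟨h₁, h₂, h₃⟩ := H.col_sum
  obtain ⟨h₄, h₅⟩ := H.row_lt
  obtain ⟨h₆, h₇⟩ := H.corner_lt
  by_contra! hw
  have k₀ := H.split₃ ![true, false, false, true, true, false]
  have k₁ := H.split₂ ![false, false, true, false, false, true]
  have k₂ := H.split₃ ![true, false, false, false, false, true]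
  have k₃ := H.split₂ ![true, false, false, true, true, false]
  have k₄ := H.split₃ ![true, true, false, false, false, true]
  have k₅ := H.split₃ ![false, true, false, false, true, false]
  have k₆ := H.split₃ ![true, false, false, true, false, true]
  have k₇ := H.split₃ ![true, false, true, false, false, true]
  have k₈ := H.split₃ ![true, false, false, false, true, true]
  have k₉ := H.split₂ ![true, false, false, false, true, true]
  simp [colourVal, Fin.sum_univ_six] at k₀ k₁ k₂ k₃ k₄ k₅ k₆ k₇ k₈ k₉
  replace k₀ := k₀.resolve_left (by linarith)
  replace k₁ := k₁.resolve_right (by linarith)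
  replace k₂ := k₂.resolve_right (by linarith)
  replace k₃ := k₃.resolve_right (by linarith)
  replace k₄ := k₄.resolve_right (by linarith)
  replace k₅ := k₅.resolve_right (by linarith)
  replace k₆ := k₆.resolve_right (by linarith)
  replace k₇ := k₇.resolve_right (by linarith)
  replace k₈ := k₈.resolve_right (by linarith)
  replace k₉ := k₉.resolve_right (by linarith)
  linarith

theorem skew_lt (H : IsLopsided a b c d e f g h i) : a + b + h < 11 / 12 := by
  obtain ⟨ha, hb, hc, hd, he, hf, hg, hh, hi⟩ := H.nonneg
  obtain ⟨h₁, h₂, h₃⟩ := H.col_sum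
  obtain ⟨h₄, h₅⟩ := H.row_lt
  obtain ⟨h₆, h₇⟩ := H.corner_lt
  have l₁ := H.bend_lt
  have l₂ := H.swap_cols.bend_lt
  have l₃ := H.swap_rows.bend_lt
  have l₄ := H.swap_rows.swap_cols.bend_lt
  have k₁ := H.split₃ ![true, true, false, false, true, false]
  simp [colourVal, Fin.sum_univ_six] at k₁
  rcases k₁ with k₁ | k₁ <;> linarith

theorem transversal_lt (H : IsLopsided a b c d e f g h i) : a + b + i < 11 / 12 := by
  obtain ⟨ha, hb, hc, hd, he, hf, hg, hh, hi⟩ := H.nonneg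
  obtain ⟨h₁, h₂, h₃⟩ := H.col_sum
  obtain ⟨h₄, h₅⟩ := H.row_lt
  obtain ⟨h₆, h₇⟩ := H.corner_lt
  have l₁ := H.bend_lt
  have l₂ := H.swap_cols.bend_lt
  have l₃ := H.swap_rows.bend_lt
  have l₄ := H.swap_rows.swap_cols.bend_lt
  have l₅ := H.skew_lt
  have l₆ := H.swap_cols.skew_lt
  have l₇ := H.swap_rows.skew_lt
  have l₈ := H.swap_rows.swap_cols.skew_lt
  have k₁ := H.split₃ ![true, true, false, false, false, true]
  have k₂ := H.split₃ ![false, false, true, false, true, true]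
  have k₃ := H.split₂ ![true, true, false, false, false, true]
  simp [colourVal, Fin.sum_univ_six] at k₁ k₂ k₃
  rcases k₁ with k₁ | k₁
  · linarith
  · rcases k₂ with k₂ | k₂ <;> rcases k₃ with k₃ | k₃ <;> linarith

theorem second_le (H : IsLopsided a b c d e f g h i) (hf₁ : c + e + f < 11 / 12)
    (hf₂ : c + h + i < 11 / 12) : False := by
  obtain ⟨ha, hb, hc, hd, he, hf, hg, hh, hi⟩ := H.nonneg
  obtain ⟨h₁, h₂, h₃⟩ := H.col_sum
  obtain ⟨h₄, h₅⟩ := H.row_lt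
  obtain ⟨h₆, h₇⟩ := H.corner_lt
  have l₁ := H.bend_lt
  have l₂ := H.swap_cols.bend_lt
  have l₃ := H.swap_rows.bend_lt
  have l₄ := H.swap_rows.swap_cols.bend_lt
  have l₅ := H.skew_lt
  have l₆ := H.swap_cols.skew_lt
  have l₇ := H.swap_rows.skew_lt
  have l₈ := H.swap_rows.swap_cols.skew_lt
  have l₉ := H.transversal_lt
  have m₁ := H.swap_cols.transversal_lt
  have m₂ := H.swap_rows.transversal_lt
  have m₃ := H.swap_rows.swap_cols.transversal_lt
  linarith

end IsLopsided

/-- The value of the cells of the matrix `x` that carry the label `k`. -/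
def labelVal (x : Fin 3 → Fin 3 → ℝ) (f : Fin 3 → Fin 3 → Fin 3) (k : Fin 3) : ℝ :=
  ∑ i, ∑ j, if f i j = k then x i j else 0

/-- No labelling of the cells gives label `0` value `11/12` for `r`, label `1` value `11/12` for
`c` and label `2` value `p` for `u`. -/
def Unshareable (p : ℝ) (r c u : Fin 3 → Fin 3 → ℝ) : Prop :=
  ∀ f : Fin 3 → Fin 3 → Fin 3,
    ¬(11 / 12 ≤ labelVal r f 0 ∧ 11 / 12 ≤ labelVal c f 1 ∧ p ≤ labelVal u f 2)

/-- In every two-colouring, some colour is worth little both for `w` and for `x`. -/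
def Aligned (p : ℝ) (w x : Fin 6 → ℝ) : Prop :=
  ∀ s : Fin 6 → Bool, (colourVal w s true < 11 / 12 ∧ colourVal x s true < p) ∨
    (colourVal w s false < 11 / 12 ∧ colourVal x s false < p)

theorem Aligned.unsplittable {p : ℝ} {w x : Fin 6 → ℝ} (H : Aligned p w x) : Unsplittable w :=
  fun s => (H s).imp And.left And.left

theorem labelVal_perm (x : Fin 3 → Fin 3 → ℝ) (f : Fin 3 → Fin 3 → Fin 3) (k : Fin 3)
    (σ τ : Equiv.Perm (Fin 3)) :
    labelVal x (fun i j => f (σ.symm i) (τ.symm j)) k =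
      labelVal (fun i j => x (σ i) (τ j)) f k := by
  unfold labelVal
  rw [← Equiv.sum_comp σ]
  refine Finset.sum_congr rfl fun i _ => ?_
  rw [← Equiv.sum_comp τ]
  simp

theorem labelVal_transpose (x : Fin 3 → Fin 3 → ℝ) (f : Fin 3 → Fin 3 → Fin 3) (k : Fin 3)
    (σ : Equiv.Perm (Fin 3)) :
    labelVal x (fun i j => σ (f j i)) (σ k) = labelVal (fun i j => x j i) f k := by
  unfold labelVal
  rw [Finset.sum_comm]
  simp

namespace Unshareable

variable {p : ℝ} {r c u : Fin 3 → Fin 3 → ℝ}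

theorem perm (H : Unshareable p r c u) (σ τ : Equiv.Perm (Fin 3)) :
    Unshareable p (fun i j => r (σ i) (τ j)) (fun i j => c (σ i) (τ j))
      (fun i j => u (σ i) (τ j)) := by
  intro f
  simpa only [labelVal_perm] using H fun i j => f (σ.symm i) (τ.symm j)

theorem transpose (H : Unshareable p r c u) :
    Unshareable p (fun i j => c j i) (fun i j => r j i) (fun i j => u j i) := by
  rintro f ⟨h₀, h₁, h₂⟩
  rw [← labelVal_transpose _ _ _ (Equiv.swap 0 1)] at h₀ h₁ h₂
  exact H _ ⟨h₁, h₀, h₂⟩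

theorem aligned (H : Unshareable p r c u) (hr : 11 / 12 ≤ r 2 0 + r 2 1 + r 2 2)
    (hc : 11 / 6 < c 0 0 + c 0 1 + c 0 2 + c 1 0 + c 1 1 + c 1 2)
    (hu : 2 * p < u 0 0 + u 0 1 + u 0 2 + u 1 0 + u 1 1 + u 1 2) :
    Aligned p ![c 0 0, c 0 1, c 0 2, c 1 0, c 1 1, c 1 2]
      ![u 0 0, u 0 1, u 0 2, u 1 0, u 1 1, u 1 2] := by
  have total : ∀ (w : Fin 6 → ℝ) (s : Fin 6 → Bool),
      colourVal w s true + colourVal w s false = ∑ k, w k := by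
    intro w s
    simp only [colourVal, ← Finset.sum_add_distrib]
    refine Finset.sum_congr rfl fun k _ => ?_
    cases s k <;> simp
  have key : ∀ (s : Fin 6 → Bool) (b : Bool),
      11 / 12 ≤ colourVal ![c 0 0, c 0 1, c 0 2, c 1 0, c 1 1, c 1 2] s b →
      colourVal ![u 0 0, u 0 1, u 0 2, u 1 0, u 1 1, u 1 2] s (!b) < p := by
    intro s b hs
    by_contra! hs'
    have e₀ : ∀ a : Bool, (if a = b then (1 : Fin 3) else 2) ≠ 0 := by
      intro a
      split_ifs <;> decide
    have e₂ : ∀ (a : Bool) (x : ℝ),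
        (if a = !b then x else 0) = if a = b then 0 else x := by
      intro a x
      cases a <;> cases b <;> simp
    refine H ![![if s 0 = b then 1 else 2, if s 1 = b then 1 else 2, if s 2 = b then 1 else 2],
      ![if s 3 = b then 1 else 2, if s 4 = b then 1 else 2, if s 5 = b then 1 else 2],
      ![0, 0, 0]] ⟨?_, ?_, ?_⟩
    · simp [labelVal, Fin.sum_univ_three, e₀]; linarith
    · simp [colourVal, Fin.sum_univ_six] at hs
      simp [labelVal, Fin.sum_univ_three,]; linarith
    · simp [colourVal, Fin.sum_univ_six, e₂] at hs'
      simp [labelVal, Fin.sum_univ_three]; linarith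
  intro s
  have hc' := total ![c 0 0, c 0 1, c 0 2, c 1 0, c 1 1, c 1 2] s
  have hu' := total ![u 0 0, u 0 1, u 0 2, u 1 0, u 1 1, u 1 2] s
  simp [Fin.sum_univ_six] at hc' hu'
  by_cases hs : 11 / 12 ≤ colourVal ![c 0 0, c 0 1, c 0 2, c 1 0, c 1 1, c 1 2] s true
  · have h₁ := key s true hs
    simp only [Bool.not_true] at h₁
    right
    refine ⟨?_, h₁⟩
    by_contra! h₂
    have h₃ := key s false h₂
    simp only [Bool.not_false] at h₃
    linarith
  · have h₃ := key s false (by linarith)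
    exact Or.inl ⟨by linarith, h₃⟩

theorem exists_row (H : Unshareable p r c u) (hr : ∀ i, 11 / 12 ≤ r i 0 + r i 1 + r i 2)
    (hc : ∀ j, c 0 j + c 1 j + c 2 j = 1) (hu : ∑ i, (u i 0 + u i 1 + u i 2) = 3 * p) :
    ∃ i, ∀ k, k ≠ i → c k 0 + c k 1 + c k 2 < 11 / 12 ∧ u k 0 + u k 1 + u k 2 < p := by
  have key : ∀ b d, b ≠ d → 11 / 12 ≤ c b 0 + c b 1 + c b 2 → u d 0 + u d 1 + u d 2 < p := by
    intro b d hbd hb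
    by_contra! hd
    have h₀ := hr 0
    have h₁ := hr 1
    have h₂ := hr 2
    refine H (fun i _ => if i = b then 1 else if i = d then 2 else 0) ⟨?_, ?_, ?_⟩ <;>
      fin_cases b <;> fin_cases d <;> simp_all [labelVal, Fin.sum_univ_three]
  obtain ⟨i, hi⟩ : ∃ i, 11 / 12 ≤ c i 0 + c i 1 + c i 2 := by
    by_contra! h
    linarith [h 0, h 1, h 2, hc 0, hc 1, hc 2]
  have hk : ∀ k, k ≠ i → u k 0 + u k 1 + u k 2 < p := fun k hk => key i k hk.symm hi
  have hi' : p ≤ u i 0 + u i 1 + u i 2 := by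
    rw [Fin.sum_univ_three] at hu
    have h₀ := hk 0
    have h₁ := hk 1
    have h₂ := hk 2
    fin_cases i <;> simp at * <;> linarith
  refine ⟨i, fun k hki => ⟨?_, hk k hki⟩⟩
  by_contra! h
  linarith [key k i hki h]

theorem contradiction_of_corner (H : Unshareable p r c u)
    (hr₀ : ∀ i j, 0 ≤ r i j) (hc₀ : ∀ i j, 0 ≤ c i j)
    (hr : ∀ i, r i 0 + r i 1 + r i 2 = 1) (hc : ∀ j, c 0 j + c 1 j + c 2 j = 1)
    (hu : ∑ i, (u i 0 + u i 1 + u i 2) = 3 * p)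
    (hrow : ∀ k, k ≠ 0 → c k 0 + c k 1 + c k 2 < 11 / 12 ∧ u k 0 + u k 1 + u k 2 < p)
    (hcol : ∀ k, k ≠ 0 → r 0 k + r 1 k + r 2 k < 11 / 12 ∧ u 0 k + u 1 k + u 2 k < p) :
    False := by
  have hr' := hr 0
  have hr'' := hr 1
  have hr''' := hr 2
  have hc' := hc 0
  have hc'' := hc 1
  have hc''' := hc 2
  obtain ⟨row₁, urow₁⟩ := hrow 1 (by simp)
  obtain ⟨row₂, urow₂⟩ := hrow 2 (by simp)
  obtain ⟨col₁, ucol₁⟩ := hcol 1 (by simp)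
  obtain ⟨col₂, ucol₂⟩ := hcol 2 (by simp)
  rw [Fin.sum_univ_three] at hu
  have W₂ := H.aligned (by linarith) (by linarith) (by linarith)
  have W₃ := (H.perm (Equiv.swap 1 2) 1).aligned
  have V₂ := H.transpose.aligned (by linarith) (by linarith) (by linarith)
  have V₃ := (H.perm 1 (Equiv.swap 1 2)).transpose.aligned
  simp only [Equiv.swap_apply_left, Equiv.swap_apply_right, Equiv.Perm.coe_one, id_eq,
    Equiv.swap_apply_of_ne_of_ne (show (0 : Fin 3) ≠ 1 by decide)
      (show (0 : Fin 3) ≠ 2 by decide)] at W₃ V₃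
  replace W₃ := W₃ (by linarith) (by linarith) (by linarith)
  replace V₃ := V₃ (by linarith) (by linarith) (by linarith)
  have u01 : u 0 0 + u 0 1 < p := by
    have h := V₂ ![true, false, false, true, false, false]
    simp [colourVal, Fin.sum_univ_six] at h
    rcases h with h | h <;> linarith [hr₀ 0 2]
  have u02 : u 0 0 + u 0 2 < p := by
    have h := V₃ ![true, false, false, true, false, false]
    simp [colourVal, Fin.sum_univ_six] at h
    rcases h with h | h <;> linarith [hr₀ 0 1]
  have u03 : u 0 0 + u 1 0 < p := by
    have h := W₂ ![true, false, false, true, false, false]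
    simp [colourVal, Fin.sum_univ_six] at h
    rcases h with h | h <;> linarith [hc₀ 2 0]
  have u06 : u 0 0 + u 2 0 < p := by
    have h := W₃ ![true, false, false, true, false, false]
    simp [colourVal, Fin.sum_univ_six] at h
    rcases h with h | h <;> linarith [hc₀ 1 0]
  have c01 : c 0 0 + c 0 1 < 11 / 12 := by
    have h := W₂ ![true, true, false, false, false, false]
    simp [colourVal, Fin.sum_univ_six] at h
    rcases h with h | h <;> linarith
  have c02 : c 0 0 + c 0 2 < 11 / 12 := by
    have h := W₃ ![true, false, true, false, false, false]
    simp [colourVal, Fin.sum_univ_six] at h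
    rcases h with h | h <;> linarith
  have r03 : r 0 0 + r 1 0 < 11 / 12 := by
    have h := V₂ ![true, true, false, false, false, false]
    simp [colourVal, Fin.sum_univ_six] at h
    rcases h with h | h <;> linarith
  have r06 : r 0 0 + r 2 0 < 11 / 12 := by
    have h := V₃ ![true, false, true, false, false, false]
    simp [colourVal, Fin.sum_univ_six] at h
    rcases h with h | h <;> linarith
  have C : IsLopsided (c 0 0) (c 0 1) (c 0 2) (c 1 0) (c 1 1) (c 1 2) (c 2 0) (c 2 1) (c 2 2) := by
    exact ⟨by simp only [hc₀, and_self], ⟨hc 0, hc 1, hc 2⟩, ⟨row₁, row₂⟩, ⟨c01, c02⟩,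
      W₂.unsplittable, W₃.unsplittable⟩
  have R : IsLopsided (r 0 0) (r 1 0) (r 2 0) (r 0 1) (r 1 1) (r 2 1) (r 0 2) (r 1 2) (r 2 2) := by
    exact ⟨by simp only [hr₀, and_self], ⟨hr 0, hr 1, hr 2⟩, ⟨col₁, col₂⟩, ⟨r03, r06⟩,
      V₂.unsplittable, V₃.unsplittable⟩
  have a013 := W₂ ![true, true, false, true, false, false]
  have b013 := V₂ ![true, true, false, true, false, false]
  have a023 := W₂ ![true, false, true, true, false, false]
  have b023 := V₃ ![true, true, false, true, false, false]
  have a016 := W₃ ![true, true, false, true, false, false]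
  have b016 := V₂ ![true, false, true, true, false, false]
  have a026 := W₃ ![true, false, true, true, false, false]
  have b026 := V₃ ![true, false, true, true, false, false]
  simp [colourVal, Fin.sum_univ_six] at a013 a023 a016 a026 b013 b023 b016 b026
  rcases a013 with a013 | a013 <;> rcases a026 with a026 | a026 <;>
    rcases a023 with a023 | a023 <;> rcases a016 with a016 | a016 <;>
    first
    | linarith
    | exact C.second_le (by linarith) (by linarith)
    | exact C.swap_cols.second_le (by linarith) (by linarith)
    | exact R.second_le (b013.resolve_left fun h => by linarith).1
        (b023.resolve_left fun h => by linarith).1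
    | exact R.swap_cols.second_le
        (by rw [add_right_comm]; exact (b016.resolve_left fun h => by linarith).1)
        (by rw [add_right_comm]; exact (b026.resolve_left fun h => by linarith).1)

end Unshareable

theorem exists_normalised {m : ℝ} {r : Fin 3 → Fin 3 → ℝ} (hr₀ : ∀ i j, 0 ≤ r i j)
    (hm : ∀ i, m ≤ ∑ j, r i j) : ∃ s : Fin 3 → Fin 3 → ℝ, (∀ i j, 0 ≤ s i j) ∧
      (∀ i, s i 0 + s i 1 + s i 2 = 1) ∧ ∀ i j, m * s i j ≤ r i j := by
  have row : ∀ i, ∃ s : Fin 3 → ℝ, (∀ j, 0 ≤ s j) ∧ s 0 + s 1 + s 2 = 1 ∧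
      ∀ j, m * s j ≤ r i j := by
    intro i
    have h₀ : 0 ≤ ∑ j, r i j := Finset.sum_nonneg fun j _ => hr₀ i j
    rcases h₀.eq_or_lt with h | h
    · refine ⟨fun _ => 1 / 3, fun _ => by norm_num, by norm_num, fun j => ?_⟩
      linarith [hr₀ i j, hm i]
    · refine ⟨fun j => r i j / ∑ j, r i j, fun j => div_nonneg (hr₀ i j) h₀, ?_, fun j => ?_⟩
      · rw [← add_div, ← add_div, ← Fin.sum_univ_three (r i), div_self h.ne']
      · rw [← mul_div_assoc, div_le_iff₀ h, mul_comm]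
        exact mul_le_mul_of_nonneg_left (hm i) (hr₀ i j)
  choose s hs using row
  exact ⟨s, fun i => (hs i).1, fun i => (hs i).2.1, fun i => (hs i).2.2⟩

theorem not_unshareable {p : ℝ} {r c u : Fin 3 → Fin 3 → ℝ} (hr₀ : ∀ i j, 0 ≤ r i j)
    (hc₀ : ∀ i j, 0 ≤ c i j) (hr : ∀ i, r i 0 + r i 1 + r i 2 = 1)
    (hc : ∀ j, c 0 j + c 1 j + c 2 j = 1) (hu : ∑ i, ∑ j, u i j = 3 * p) :
    ¬Unshareable p r c u := by
  intro H
  have hu' : ∑ j, ∑ i, u i j = 3 * p := by rw [Finset.sum_comm, hu]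
  obtain ⟨i, hi⟩ := H.exists_row (fun i => by rw [hr]; norm_num) hc
    (by simpa only [Fin.sum_univ_three] using hu)
  obtain ⟨j, hj⟩ := H.transpose.exists_row (fun j => by rw [hc]; norm_num) hr
    (by simpa only [Fin.sum_univ_three] using hu')
  have sum_swap : ∀ (x : Fin 3 → ℝ) (l : Fin 3),
      x (Equiv.swap 0 l 0) + x (Equiv.swap 0 l 1) + x (Equiv.swap 0 l 2) = x 0 + x 1 + x 2 := by
    intro x l
    rw [← Fin.sum_univ_three x, ← Equiv.sum_comp (Equiv.swap 0 l) x, Fin.sum_univ_three]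
  have ne : ∀ k l : Fin 3, k ≠ 0 → Equiv.swap 0 l k ≠ l := by decide
  refine (H.perm (Equiv.swap 0 i) (Equiv.swap 0 j)).contradiction_of_corner
    (fun _ _ => hr₀ _ _) (fun _ _ => hc₀ _ _) (fun k => ?_) (fun k => ?_) ?_
    (fun k hk => ⟨?_, ?_⟩) (fun k hk => ⟨?_, ?_⟩)
  · rw [sum_swap (r _), hr]
  · rw [sum_swap fun k => c k _, hc]
  · rw [Equiv.sum_comp (Equiv.swap 0 i) fun l => u l _ + u l _ + u l _, ← hu]
    exact Finset.sum_congr rfl fun k _ => by rw [sum_swap (u k), Fin.sum_univ_three]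
  · rw [sum_swap (c _)]
    exact (hi _ (ne k i hk)).1
  · rw [sum_swap (u _)]
    exact (hi _ (ne k i hk)).2
  · rw [sum_swap fun l => r l _]
    exact (hj _ (ne k j hk)).1
  · rw [sum_swap fun l => u l _]
    exact (hj _ (ne k j hk)).2

/-- The value of the items that the partitions `f` and `g` put in the bundles `i` and `j`. -/
noncomputable def cellVal {M : Type*} [Fintype M] (v : M → ℝ) (f g : M → Fin 3)
    (i j : Fin 3) : ℝ :=
  ∑ e ∈ Finset.univ.filter (fun e => f e = i ∧ g e = j), v e

theorem cellVal_nonneg {M : Type*} [Fintype M] {v : M → ℝ} (hv : ∀ e, 0 ≤ v e)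
    (f g : M → Fin 3) (i j : Fin 3) : 0 ≤ cellVal v f g i j :=
  Finset.sum_nonneg fun e _ => hv e

theorem labelVal_cellVal {M : Type*} [Fintype M] (v : M → ℝ) (f g : M → Fin 3)
    (L : Fin 3 → Fin 3 → Fin 3) (k : Fin 3) :
    labelVal (cellVal v f g) L k = bundleVal v (fun e => L (f e) (g e)) k := by
  unfold labelVal cellVal bundleVal
  simp only [Finset.sum_filter, ite_and]
  have key : ∀ i j, (if L i j = k then
      ∑ e, if f e = i then if g e = j then v e else 0 else 0 else 0) =
      ∑ e, if f e = i then if g e = j then if L i j = k then v e else 0 else 0 else 0 := by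
    intro i j
    by_cases h : L i j = k <;> simp [h]
  simp only [key]
  simp only [Finset.sum_comm (t := (Finset.univ : Finset M))]
  simp

theorem sum_cellVal_right {M : Type*} [Fintype M] (v : M → ℝ) (f g : M → Fin 3) (i : Fin 3) :
    ∑ j, cellVal v f g i j = bundleVal v f i := by
  simp only [cellVal, bundleVal, Finset.sum_filter, ite_and]
  rw [Finset.sum_comm]
  exact Finset.sum_congr rfl fun e _ => by by_cases h : f e = i <;> simp [h]

theorem sum_cellVal_left {M : Type*} [Fintype M] (v : M → ℝ) (f g : M → Fin 3) (j : Fin 3) :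
    ∑ i, cellVal v f g i j = bundleVal v g j := by
  simp only [cellVal, bundleVal, Finset.sum_filter, ite_and]
  rw [Finset.sum_comm]
  simp

theorem sum_sum_cellVal {M : Type*} [Fintype M] (v : M → ℝ) (f g : M → Fin 3) :
    ∑ i, ∑ j, cellVal v f g i j = ∑ e, v e := by
  simp only [sum_cellVal_right, bundleVal, Finset.sum_fiberwise]

theorem labelVal_mul_le {m : ℝ} {x y : Fin 3 → Fin 3 → ℝ} (h : ∀ i j, m * x i j ≤ y i j)
    (L : Fin 3 → Fin 3 → Fin 3) (k : Fin 3) : m * labelVal x L k ≤ labelVal y L k := by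
  simp only [labelVal, Finset.mul_sum]
  refine Finset.sum_le_sum fun i _ => Finset.sum_le_sum fun j _ => ?_
  split_ifs
  · exact h i j
  · simp

theorem MMS_nonneg {M : Type*} [Fintype M] [DecidableEq M] {v : M → ℝ} (hv : ∀ e, 0 ≤ v e) :
    0 ≤ MMS 3 v :=
  Finset.le_sup'_of_le _ (Finset.mem_univ fun _ => 0) <|
    Finset.le_inf' _ _ fun _ _ => Finset.sum_nonneg fun e _ => hv e

theorem exists_partition_MMS_le {M : Type*} [Fintype M] [DecidableEq M] (v : M → ℝ) :
    ∃ f : M → Fin 3, ∀ j, MMS 3 v ≤ bundleVal v f j := by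
  obtain ⟨f, -, hf⟩ := Finset.exists_mem_eq_sup' Finset.univ_nonempty
    fun f : M → Fin 3 => Finset.univ.inf' Finset.univ_nonempty fun j => bundleVal v f j
  refine ⟨f, fun j => ?_⟩
  unfold MMS
  rw [hf]
  exact Finset.inf'_le _ (Finset.mem_univ j)

/-- For three agents with additive nonnegative valuations over goods and a
prespecified agent u, there is an allocation giving u her full proportional share and
each other agent at least 11/12 of her maximin share (an (11/12)-P⁺MM allocation). -/
theorem exists_P_plus_MM_allocation_goods {M : Type*} [Fintype M] [DecidableEq M]
    (v : Fin 3 → M → ℝ) (hv : ∀ i e, 0 ≤ v i e) (u : Fin 3) :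
    ∃ A : M → Fin 3, PS 3 (v u) ≤ bundleVal (v u) A u ∧
      ∀ i, i ≠ u → (11/12 : ℝ) * MMS 3 (v i) ≤ bundleVal (v i) A i := by
  obtain ⟨π, rfl⟩ : ∃ π : Equiv.Perm (Fin 3), π 2 = u := ⟨Equiv.swap 2 u, by simp⟩
  obtain ⟨f, hf⟩ := exists_partition_MMS_le (v (π 0))
  obtain ⟨g, hg⟩ := exists_partition_MMS_le (v (π 1))
  have hr₀ := cellVal_nonneg (hv (π 0)) f g
  have hc₀ := cellVal_nonneg (hv (π 1)) f g
  obtain ⟨r, hr, hr₁, hr₂⟩ :=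
    exists_normalised hr₀ fun i => (hf i).trans_eq (sum_cellVal_right ..).symm
  obtain ⟨c, hc, hc₁, hc₂⟩ := exists_normalised (fun i j => hc₀ j i)
    fun j => (hg j).trans_eq (sum_cellVal_left ..).symm
  have H := not_unshareable (p := PS 3 (v (π 2))) (u := cellVal (v (π 2)) f g) hr
    (fun i j => hc j i) hr₁ hc₁ (by rw [sum_sum_cellVal]; simp [PS]; ring)
  simp only [Unshareable, not_forall, not_not] at H
  obtain ⟨L, h₀, h₁, h₂⟩ := H
  have scale : ∀ (k l : Fin 3) (x : Fin 3 → Fin 3 → ℝ),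
      (∀ i j, MMS 3 (v (π k)) * x i j ≤ cellVal (v (π k)) f g i j) →
      11 / 12 ≤ labelVal x L l →
      11 / 12 * MMS 3 (v (π k)) ≤ bundleVal (v (π k)) (fun e => L (f e) (g e)) l := by
    intro k l x hx hl
    rw [← labelVal_cellVal]
    refine le_trans ?_ (labelVal_mul_le hx L l)
    rw [mul_comm]
    exact mul_le_mul_of_nonneg_left hl (MMS_nonneg (hv _))
  have relabel : ∀ (w : M → ℝ) (k : Fin 3),
      bundleVal w (fun e => π (L (f e) (g e))) (π k) = bundleVal w (fun e => L (f e) (g e)) k := by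
    intro w k
    simp [bundleVal]
  refine ⟨fun e => π (L (f e) (g e)), ?_, fun i hi => ?_⟩
  · rwa [relabel, ← labelVal_cellVal]
  · obtain ⟨k, rfl⟩ := π.surjective i
    rw [relabel]
    have hk : k ≠ 2 := fun h => hi (h ▸ rfl)
    fin_cases k
    · exact scale 0 0 r hr₂ h₀
    · exact scale 1 1 _ (fun i j => hc₂ j i) h₁
    · exact absurd rfl hk
end

section
/- There exists an instance with three agents, named R, C and U, having additive nonnegative valuations over a finite set of items, such that in every allocation A = (A_R, A_C, A_U), either v^R(A_R) ≤ (11/12)·MMS^R, or v^C(A_C) ≤ (11/12)·MMS^C, or v^U(A_U) ≤ (11/12)·PS^U. Hence the ratio 11/12 is best possible for PMM allocations of goods to three agents. -/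
/-- The values of the nine goods to the agents R, C and U. The goods form a `3 × 3` grid, listed row
by row, in which R values every row at `12` and C values every column at `12`. -/
def gridValue : Fin 3 → Fin 9 → ℕ :=
  ![![1, 1, 10, 6, 6, 0, 4, 4, 4], ![1, 1, 9, 8, 8, 0, 3, 3, 3], ![0, 0, 11, 7, 7, 0, 4, 4, 3]]

/-- Starting from agents holding values `a`, `b`, `c`, every way of distributing the goods in the
list (given by their values to the three agents) leaves some agent with value at most `t`. -/
def everySplitFails (t : ℕ) : List (ℕ × ℕ × ℕ) → ℕ → ℕ → ℕ → Bool
  | [], a, b, c => a.ble t || b.ble t || c.ble t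
  | (x, y, z) :: l, a, b, c =>
    everySplitFails t l (a + x) b c && everySplitFails t l a (b + y) c &&
      everySplitFails t l a b (c + z)

theorem everySplitFails.sum_le {ι : Type*} {t : ℕ} (v : Fin 3 → ι → ℕ) (A : ι → Fin 3)
    (l : List ι) {a b c : ℕ}
    (h : everySplitFails t (l.map fun e => (v 0 e, v 1 e, v 2 e)) a b c = true) :
    a + (l.map fun e => if A e = 0 then v 0 e else 0).sum ≤ t ∨
      b + (l.map fun e => if A e = 1 then v 1 e else 0).sum ≤ t ∨
      c + (l.map fun e => if A e = 2 then v 2 e else 0).sum ≤ t := by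
  induction l generalizing a b c with
  | nil => simpa [everySplitFails, or_assoc] using h
  | cons e l ih =>
    simp only [List.map_cons, everySplitFails, Bool.and_eq_true] at h
    obtain ⟨⟨h₀, h₁⟩, h₂⟩ := h
    have hA : A e = 0 ∨ A e = 1 ∨ A e = 2 := by
      generalize A e = i
      revert i
      decide
    rcases hA with hA | hA | hA
    · simpa [hA, add_assoc] using ih h₀
    · simpa [hA, add_assoc] using ih h₁
    · simpa [hA, add_assoc] using ih h₂

theorem bundleVal_natCast {M : Type*} [Fintype M] {n : ℕ} (v : M → ℕ) (f : M → Fin n)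
    (j : Fin n) :
    bundleVal (fun e => (v e : ℝ)) f j = ((∑ e, if f e = j then v e else 0 : ℕ) : ℝ) := by
  simp [bundleVal, Finset.sum_filter]

theorem le_MMS {M : Type*} [Fintype M] [DecidableEq M] {n : ℕ} [NeZero n] {v : M → ℝ} {x : ℝ}
    (f : M → Fin n) (h : ∀ j, x ≤ bundleVal v f j) : x ≤ MMS n v :=
  (Finset.le_inf' _ _ fun j _ => h j).trans <|
    Finset.le_sup' (fun f : M → Fin n =>
      Finset.univ.inf' Finset.univ_nonempty fun j => bundleVal v f j) (Finset.mem_univ f)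

theorem gridValue_split (A : Fin 9 → Fin 3) :
    ∃ i, ∑ e, (if A e = i then gridValue i e else 0) ≤ 11 := by
  have h := everySplitFails.sum_le (t := 11) gridValue A (List.finRange 9) (a := 0) (b := 0)
    (c := 0) (by decide +kernel)
  simp only [zero_add, ← List.ofFn_eq_map, List.sum_ofFn] at h
  rcases h with h | h | h
  exacts [⟨0, h⟩, ⟨1, h⟩, ⟨2, h⟩]

theorem twelve_le_MMS_rows : 12 ≤ MMS 3 fun e => (gridValue 0 e : ℝ) := by
  refine le_MMS ![0, 0, 0, 1, 1, 1, 2, 2, 2] fun j => ?_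
  rw [bundleVal_natCast]
  exact_mod_cast (by decide +revert : 12 ≤ _)

theorem twelve_le_MMS_columns : 12 ≤ MMS 3 fun e => (gridValue 1 e : ℝ) := by
  refine le_MMS ![0, 1, 2, 0, 1, 2, 0, 1, 2] fun j => ?_
  rw [bundleVal_natCast]
  exact_mod_cast (by decide +revert : 12 ≤ _)

theorem PS_gridValue : PS 3 (fun e => (gridValue 2 e : ℝ)) = 12 := by
  have h : ∑ e, gridValue 2 e = 36 := by decide
  rw [PS, ← Nat.cast_sum, h]
  norm_num

/-- There is an instance with three agents R = 0, C = 1, U = 2 with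
additive nonnegative valuations over goods such that in every allocation, R gets at most
(11/12)·MMS^R, or C gets at most (11/12)·MMS^C, or U gets at most (11/12)·PS^U. -/
theorem exists_negative_instance_PMM_goods :
    ∃ (M : Type) (i1 : Fintype M) (i2 : DecidableEq M) (v : Fin 3 → M → ℝ),
      (∀ i e, 0 ≤ v i e) ∧
      ∀ A : M → Fin 3,
        @bundleVal M i1 3 (v 0) A 0 ≤ (11/12 : ℝ) * @MMS M i1 i2 3 _ (v 0) ∨
        @bundleVal M i1 3 (v 1) A 1 ≤ (11/12 : ℝ) * @MMS M i1 i2 3 _ (v 1) ∨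
        @bundleVal M i1 3 (v 2) A 2 ≤ (11/12 : ℝ) * @PS M i1 3 (v 2) := by
  refine ⟨Fin 9, inferInstance, inferInstance, fun i e => gridValue i e, fun i e => by positivity,
    fun A => ?_⟩
  obtain ⟨i, hi⟩ := gridValue_split A
  have hv : bundleVal (fun e => (gridValue i e : ℝ)) A i ≤ 11 := by
    rw [bundleVal_natCast]
    exact_mod_cast hi
  fin_cases i
  · exact .inl (hv.trans (by linarith [twelve_le_MMS_rows]))
  · exact .inr (.inl (hv.trans (by linarith [twelve_le_MMS_columns])))
  · exact .inr (.inr (hv.trans (by linarith [PS_gridValue])))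
end
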